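/- Every entry of the 5x5 matrix product J * Omega5 lies in the ideal of Q[a, b, w0, w1, w2, w3, w4] generated by the five quadratic forms p0, p1, p2, p3, p4. -/

import Mathlib

open MvPolynomial

/-- The polynomial ring `ℚ[a, b, w₀, w₁, w₂, w₃, w₄]`, with the `w` variables
indexed by `ℤ/5ℤ`. -/
abbrev R5 : Type := MvPolynomial (Fin 2 ⊕ ZMod 5) ℚ

/-- The variable `a`. -/
noncomputable def va : R5 := X (Sum.inl 0)

/-- The variable `b`. -/
noncomputable def vb : R5 := X (Sum.inl 1)

/-- The variable `w_i`, `i ∈ ℤ/5ℤ`. -/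
noncomputable def vw (i : ZMod 5) : R5 := X (Sum.inr i)

/-- The quadratic form `p_i = a b w_i² + b² w_{i-1} w_{i+1} - a² w_{i-2} w_{i+2}`. -/
noncomputable def pq (i : ZMod 5) : R5 :=
  va * vb * vw i ^ 2 + vb ^ 2 * vw (i - 1) * vw (i + 1) - va ^ 2 * vw (i - 2) * vw (i + 2)

/-- The Jacobian matrix `J = (∂p_i/∂w_j)`. -/
noncomputable def Jmat : Matrix (ZMod 5) (ZMod 5) R5 :=
  Matrix.of fun i j => pderiv (Sum.inr j) (pq i)

/-- `α_i = 5a⁴b w_i² - 10a³b² w_{i-1}w_{i+1} + (a⁵ - 3b⁵) w_{i-2}w_{i+2}`. -/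
noncomputable def alphaq (i : ZMod 5) : R5 :=
  5 * va ^ 4 * vb * vw i ^ 2 - 10 * va ^ 3 * vb ^ 2 * vw (i - 1) * vw (i + 1)
    + (va ^ 5 - 3 * vb ^ 5) * vw (i - 2) * vw (i + 2)

/-- `β_i = 5ab⁴ w_i² - (3a⁵ + b⁵) w_{i-1}w_{i+1} + 10a²b³ w_{i-2}w_{i+2}`. -/
noncomputable def betaq (i : ZMod 5) : R5 :=
  5 * va * vb ^ 4 * vw i ^ 2 - (3 * va ^ 5 + vb ^ 5) * vw (i - 1) * vw (i + 1)
    + 10 * va ^ 2 * vb ^ 3 * vw (i - 2) * vw (i + 2)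

/-- The alternating matrix `Ω₅`, whose first row is `(0, α₃, β₁, -β₄, -α₂)`,
second row `(-α₃, 0, α₄, β₂, -β₀)`, third row `(-β₁, -α₄, 0, α₀, β₃)`,
fourth row `(β₄, -β₂, -α₀, 0, α₁)` and fifth row `(α₂, β₀, -β₃, -α₁, 0)`. -/
noncomputable def Omega5 : Matrix (ZMod 5) (ZMod 5) R5 :=
  Matrix.of fun i j =>
    if j = i + 1 then alphaq (i + 3)
    else if j = i + 2 then betaq (i + 1)
    else if j = i + 3 then -betaq (i + 4)
    else if j = i + 4 then -alphaq (i + 2)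
    else 0

lemma idx_add : (1 : ZMod 5) + 1 = 2 ∧
    (1 : ZMod 5) + 2 = 3 ∧
    (1 : ZMod 5) + 3 = 4 ∧
    (1 : ZMod 5) + 4 = 0 ∧
    (2 : ZMod 5) + 1 = 3 ∧
    (2 : ZMod 5) + 2 = 4 ∧
    (2 : ZMod 5) + 3 = 0 ∧
    (2 : ZMod 5) + 4 = 1 ∧
    (3 : ZMod 5) + 1 = 4 ∧
    (3 : ZMod 5) + 2 = 0 ∧
    (3 : ZMod 5) + 3 = 1 ∧
    (3 : ZMod 5) + 4 = 2 ∧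
    (4 : ZMod 5) + 1 = 0 ∧
    (4 : ZMod 5) + 2 = 1 ∧
    (4 : ZMod 5) + 3 = 2 ∧
    (4 : ZMod 5) + 4 = 3 := by
  decide

lemma idx_ne : ((0 : ZMod 5) = 1) = False ∧
    ((0 : ZMod 5) = 2) = False ∧
    ((0 : ZMod 5) = 3) = False ∧
    ((0 : ZMod 5) = 4) = False ∧
    ((1 : ZMod 5) = 0) = False ∧
    ((1 : ZMod 5) = 2) = False ∧
    ((1 : ZMod 5) = 3) = False ∧
    ((1 : ZMod 5) = 4) = False ∧
    ((2 : ZMod 5) = 0) = False ∧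
    ((2 : ZMod 5) = 1) = False ∧
    ((2 : ZMod 5) = 3) = False ∧
    ((2 : ZMod 5) = 4) = False ∧
    ((3 : ZMod 5) = 0) = False ∧
    ((3 : ZMod 5) = 1) = False ∧
    ((3 : ZMod 5) = 2) = False ∧
    ((3 : ZMod 5) = 4) = False ∧
    ((4 : ZMod 5) = 0) = False ∧
    ((4 : ZMod 5) = 1) = False ∧
    ((4 : ZMod 5) = 2) = False ∧
    ((4 : ZMod 5) = 3) = False := by
  simp only [eq_iff_iff, iff_false]
  decide

lemma idx_sub (i : ZMod 5) : i - 1 = i + 4 ∧ i - 2 = i + 3 := by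
  revert i; decide

lemma pq_eq (i : ZMod 5) : pq i =
    va * vb * vw i ^ 2 + vb ^ 2 * vw (i + 4) * vw (i + 1) - va ^ 2 * vw (i + 3) * vw (i + 2) := by
  rw [pq, (idx_sub i).1, (idx_sub i).2]

lemma alphaq_eq (i : ZMod 5) : alphaq i =
    5 * va ^ 4 * vb * vw i ^ 2 - 10 * va ^ 3 * vb ^ 2 * vw (i + 4) * vw (i + 1)
    + (va ^ 5 - 3 * vb ^ 5) * vw (i + 3) * vw (i + 2) := by
  rw [alphaq, (idx_sub i).1, (idx_sub i).2]

lemma betaq_eq (i : ZMod 5) : betaq i =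
    5 * va * vb ^ 4 * vw i ^ 2 - (3 * va ^ 5 + vb ^ 5) * vw (i + 4) * vw (i + 1)
    + 10 * va ^ 2 * vb ^ 3 * vw (i + 3) * vw (i + 2) := by
  rw [betaq, (idx_sub i).1, (idx_sub i).2]

lemma pderiv_vw (i j : ZMod 5) :
    pderiv (Sum.inr j) (vw i) = if i = j then (1 : R5) else 0 := by
  simp [vw, pderiv_X, Pi.single_apply]

lemma pderiv_va (j : ZMod 5) : pderiv (Sum.inr j) va = 0 := by
  simp [va, pderiv_X]

lemma pderiv_vb (j : ZMod 5) : pderiv (Sum.inr j) vb = 0 := by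
  simp [vb, pderiv_X]

lemma Jmat_eq (i j : ZMod 5) : Jmat i j =
    2 * va * vb * vw i * (if i = j then 1 else 0)
    + vb ^ 2 * (vw (i + 4) * (if i + 1 = j then 1 else 0) + vw (i + 1) * (if i + 4 = j then 1 else 0))
    - va ^ 2 * (vw (i + 3) * (if i + 2 = j then 1 else 0)
      + vw (i + 2) * (if i + 3 = j then 1 else 0)) := by
  simp only [Jmat, Matrix.of_apply, pq_eq, map_sub, map_add, Derivation.leibniz,
    Derivation.leibniz_pow, pderiv_vw, pderiv_va, pderiv_vb, smul_eq_mul, nsmul_eq_mul]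
  push_cast
  ring

/-- The sparse expansion of an entry of the product along row `i` of `J`. -/
lemma prod_eq (i j : ZMod 5) : (Jmat * Omega5) i j =
    2 * va * vb * vw i * Omega5 i j
    + vb ^ 2 * (vw (i + 4) * Omega5 (i + 1) j + vw (i + 1) * Omega5 (i + 4) j)
    - va ^ 2 * (vw (i + 3) * Omega5 (i + 2) j + vw (i + 2) * Omega5 (i + 3) j) := by
  simp only [Matrix.mul_apply, Jmat_eq, add_mul, sub_mul, mul_add, Finset.sum_add_distrib,
    Finset.sum_sub_distrib, mul_assoc, ← Finset.mul_sum, ite_mul, one_mul, zero_mul,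
    Finset.sum_ite_eq, Finset.mem_univ, if_true]

lemma Omega5_shift (i e d : ZMod 5) : Omega5 (i + e) (i + d) =
    if d = e + 1 then alphaq (i + (e + 3))
    else if d = e + 2 then betaq (i + (e + 1))
    else if d = e + 3 then -betaq (i + (e + 4))
    else if d = e + 4 then -alphaq (i + (e + 2))
    else 0 := by
  simp only [Omega5, Matrix.of_apply, add_assoc, add_right_inj]

lemma prod_shift (i d : ZMod 5) : (Jmat * Omega5) i (i + d) =
    2 * va * vb * vw (i + 0) * Omega5 (i + 0) (i + d)
    + vb ^ 2 * (vw (i + 4) * Omega5 (i + 1) (i + d) + vw (i + 1) * Omega5 (i + 4) (i + d))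
    - va ^ 2 * (vw (i + 3) * Omega5 (i + 2) (i + d) + vw (i + 2) * Omega5 (i + 3) (i + d)) := by
  rw [prod_eq, add_zero]

lemma cert0 (i : ZMod 5) : (Jmat * Omega5) i (i + 0) =
    (-5) * va ^ 3 * vb ^ 2 * vw (i + 1) * pq (i + 2)
    + (5) * va ^ 3 * vb ^ 2 * vw (i + 4) * pq (i + 3) := by
  rw [prod_shift]
  simp only [Omega5_shift]
  simp only [idx_add, idx_ne, if_true, if_false, pq_eq, alphaq_eq, betaq_eq,
    add_assoc, zero_add, add_zero]
  ring

lemma cert1 (i : ZMod 5) : (Jmat * Omega5) i (i + 1) =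
    (-1) * va ^ 0 * vb ^ 5 * vw (i + 1) * pq (i + 0)
    + (2) * va ^ 5 * vb ^ 0 * vw (i + 1) * pq (i + 0)
    + (-5) * va ^ 4 * vb ^ 1 * vw (i + 4) * pq (i + 1)
    + (5) * va ^ 2 * vb ^ 3 * vw (i + 2) * pq (i + 2) := by
  rw [prod_shift]
  simp only [Omega5_shift]
  simp only [idx_add, idx_ne, if_true, if_false, pq_eq, alphaq_eq, betaq_eq,
    add_assoc, zero_add, add_zero]
  ring

lemma cert2 (i : ZMod 5) : (Jmat * Omega5) i (i + 2) =
    (-2) * va ^ 0 * vb ^ 5 * vw (i + 2) * pq (i + 0)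
    + (-1) * va ^ 5 * vb ^ 0 * vw (i + 2) * pq (i + 0)
    + (-5) * va ^ 1 * vb ^ 4 * vw (i + 3) * pq (i + 2)
    + (5) * va ^ 3 * vb ^ 2 * vw (i + 4) * pq (i + 4) := by
  rw [prod_shift]
  simp only [Omega5_shift]
  simp only [idx_add, idx_ne, if_true, if_false, pq_eq, alphaq_eq, betaq_eq,
    add_assoc, zero_add, add_zero]
  ring

lemma cert3 (i : ZMod 5) : (Jmat * Omega5) i (i + 3) =
    (2) * va ^ 0 * vb ^ 5 * vw (i + 3) * pq (i + 0)
    + (1) * va ^ 5 * vb ^ 0 * vw (i + 3) * pq (i + 0)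
    + (-5) * va ^ 3 * vb ^ 2 * vw (i + 1) * pq (i + 1)
    + (5) * va ^ 1 * vb ^ 4 * vw (i + 2) * pq (i + 3) := by
  rw [prod_shift]
  simp only [Omega5_shift]
  simp only [idx_add, idx_ne, if_true, if_false, pq_eq, alphaq_eq, betaq_eq,
    add_assoc, zero_add, add_zero]
  ring

lemma cert4 (i : ZMod 5) : (Jmat * Omega5) i (i + 4) =
    (1) * va ^ 0 * vb ^ 5 * vw (i + 4) * pq (i + 0)
    + (3) * va ^ 5 * vb ^ 0 * vw (i + 4) * pq (i + 0)
    + (-5) * va ^ 5 * vb ^ 0 * vw (i + 2) * pq (i + 1)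
    + (5) * va ^ 4 * vb ^ 1 * vw (i + 0) * pq (i + 2)
    + (-5) * va ^ 2 * vb ^ 3 * vw (i + 3) * pq (i + 3) := by
  rw [prod_shift]
  simp only [Omega5_shift]
  simp only [idx_add, idx_ne, if_true, if_false, pq_eq, alphaq_eq, betaq_eq,
    add_assoc, zero_add, add_zero]
  ring

/-- Every entry of `J * Ω₅` lies in the ideal generated by `p₀, ..., p₄`. -/
theorem J_mul_Omega5_mem_ideal :
    ∀ i j : ZMod 5, (Jmat * Omega5) i j ∈ Ideal.span (Set.range pq) := by
  intro i j
  have hp : ∀ (c : R5) (k : ZMod 5), c * pq k ∈ Ideal.span (Set.range pq) := fun c k =>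
    Ideal.mul_mem_left _ c (Ideal.subset_span ⟨k, rfl⟩)
  obtain ⟨d, rfl⟩ : ∃ d, j = i + d := ⟨j - i, by ring⟩
  have hd : d = 0 ∨ d = 1 ∨ d = 2 ∨ d = 3 ∨ d = 4 := by
    revert d; decide
  rcases hd with rfl | rfl | rfl | rfl | rfl
  · rw [cert0]; repeat' first | exact hp _ _ | apply Ideal.add_mem
  · rw [cert1]; repeat' first | exact hp _ _ | apply Ideal.add_mem
  · rw [cert2]; repeat' first | exact hp _ _ | apply Ideal.add_mem
  · rw [cert3]; repeat' first | exact hp _ _ | apply Ideal.add_mem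
  · rw [cert4]; repeat' first | exact hp _ _ | apply Ideal.add_mem
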